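/- arXiv:1702.07067 — 3 statements merged into one kernel-verified Lean document; each statement's English description precedes it below -/
import Mathlib

section
/- For every z ∈ ℂⁿ and ρ > 0, the Bargmann transform of the surface measure on the sphere of radius ρ satisfies 2^{-n/2}π^{-3n/4} e^{-z²/4} ∫_{ρS^{n-1}} e^{z·x - |x|²/2} dσ(x) = 2^{-n/2}π^{-3n/4} ρ^{n-1} e^{-ρ²/2} e^{-z²/4} Σ_ν (ρ^{2|ν|} M(ν)/(2ν)!) z^{2ν}, where M(ν) = ∫_{S^{n-1}} ω^{2ν} dσ(ω) and the sum runs over multi-indices ν ∈ (ℕ∪{0})ⁿ. -/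
open MeasureTheory

/-- The integral of `f` over the sphere of radius `ρ` in `ℝⁿ` with respect to the standard
surface measure, expressed via the unit-sphere surface measure:
`∫_{ρ S^{n-1}} f dσ = ρ^{n-1} ∫_{S^{n-1}} f(ρω) dσ(ω)`. -/
noncomputable def sphereSurfaceIntegral (n : ℕ) (ρ : ℝ)
    (f : EuclideanSpace ℝ (Fin n) → ℂ) : ℂ :=
  (ρ : ℂ) ^ (n - 1) *
    ∫ ω : Metric.sphere (0 : EuclideanSpace ℝ (Fin n)) 1,
      f (ρ • (ω : EuclideanSpace ℝ (Fin n)))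
    ∂((volume : Measure (EuclideanSpace ℝ (Fin n))).toSphere)

/-- Absolute convergence of a product of two absolutely convergent series. -/
theorem summable_norm_and_hasSum_mul {R ι κ : Type*} [NormedRing R] [CompleteSpace R]
    {f : ι → R} {g : κ → R} {a b : R} (hf : Summable fun i => ‖f i‖)
    (hg : Summable fun k => ‖g k‖) (ha : HasSum f a) (hb : HasSum g b) :
    (Summable fun p : ι × κ => ‖f p.1 * g p.2‖) ∧
      HasSum (fun p : ι × κ => f p.1 * g p.2) (a * b) :=
  ⟨hf.mul_norm hg, ha.mul hb (summable_mul_of_summable_norm hf hg)⟩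

/-- Absolute convergence of a finite product of absolutely convergent series. -/
theorem summable_norm_and_hasSum_fin_prod {R κ : Type*} [NormedCommRing R] [CompleteSpace R]
    {n : ℕ} {f : Fin n → κ → R} {a : Fin n → R}
    (hs : ∀ i, Summable fun k => ‖f i k‖) (ha : ∀ i, HasSum (f i) (a i)) :
    (Summable fun α : Fin n → κ => ‖∏ i, f i (α i)‖) ∧
      HasSum (fun α : Fin n → κ => ∏ i, f i (α i)) (∏ i, a i) := by
  induction n with
  | zero =>
    refine ⟨(hasSum_fintype _).summable, ?_⟩
    simp
  | succ n ih =>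
    obtain ⟨h₁, h₂⟩ := ih (fun i => hs i.succ) (fun i => ha i.succ)
    have hprod := summable_norm_and_hasSum_mul (hs 0) h₁ (ha 0) h₂
    constructor
    · rw [← (Fin.consEquiv fun _ : Fin (n + 1) => κ).summable_iff]
      simpa [Function.comp_def, Fin.consEquiv, Fin.prod_univ_succ] using hprod.1
    · rw [← (Fin.consEquiv fun _ : Fin (n + 1) => κ).hasSum_iff]
      simpa [Function.comp_def, Fin.consEquiv, Fin.prod_univ_succ] using hprod.2

open scoped Pointwise in
/-- A linear isometry preserves the surface measure of the unit sphere. -/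
theorem LinearIsometryEquiv.measurePreserving_toSphere {E : Type*} [NormedAddCommGroup E]
    [InnerProductSpace ℝ E] [FiniteDimensional ℝ E] [MeasurableSpace E] [BorelSpace E]
    (e : E ≃ₗᵢ[ℝ] E) :
    MeasurePreserving
      (fun ω : Metric.sphere (0 : E) 1 => (⟨e ω, by simp⟩ : Metric.sphere (0 : E) 1))
      (volume : Measure E).toSphere (volume : Measure E).toSphere := by
  have hmeas : Measurable
      (fun ω : Metric.sphere (0 : E) 1 => (⟨e ω, by simp⟩ : Metric.sphere (0 : E) 1)) :=
    Continuous.measurable (by fun_prop)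
  refine ⟨hmeas, Measure.ext fun s hs => ?_⟩
  rw [Measure.map_apply hmeas hs, Measure.toSphere_apply' _ hs,
    Measure.toSphere_apply' _ (hmeas hs)]
  congr 1
  rw [← e.measurePreserving.measure_preimage_equiv (f := e.toMeasurableEquiv)
    (Set.Ioo (0 : ℝ) 1 • (Subtype.val '' s))]
  congr 1
  ext x
  simp only [Set.mem_smul, Set.mem_image, Set.mem_preimage]
  constructor
  · rintro ⟨r, hr, _, ⟨ω, hω, rfl⟩, rfl⟩
    exact ⟨r, hr, _, ⟨_, hω, rfl⟩, by simp⟩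
  · rintro ⟨r, hr, _, ⟨ω, hω, rfl⟩, h⟩
    refine ⟨r, hr, e.symm ω, ⟨⟨e.symm ω, by simp⟩, by simpa using hω, rfl⟩, ?_⟩
    apply e.injective
    simpa using h

/-- A monomial with an odd exponent has vanishing integral over the unit sphere. -/
theorem integral_sphere_monomial_eq_zero {n : ℕ} {α : Fin n → ℕ} {i : Fin n} (hi : Odd (α i)) :
    ∫ ω : Metric.sphere (0 : EuclideanSpace ℝ (Fin n)) 1,
        ∏ j, ((ω : EuclideanSpace ℝ (Fin n)) j) ^ α j
      ∂((volume : Measure (EuclideanSpace ℝ (Fin n))).toSphere) = 0 := by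
  let e : EuclideanSpace ℝ (Fin n) ≃ₗᵢ[ℝ] EuclideanSpace ℝ (Fin n) :=
    LinearIsometryEquiv.piLpCongrRight 2 fun j =>
      if j = i then LinearIsometryEquiv.neg ℝ else LinearIsometryEquiv.refl ℝ ℝ
  have he (x : EuclideanSpace ℝ (Fin n)) (j : Fin n) : e x j = if j = i then -x j else x j := by
    by_cases h : j = i <;> simp [e, h]
  have hflip (x : EuclideanSpace ℝ (Fin n)) : ∏ j, e x j ^ α j = -∏ j, x j ^ α j := by
    rw [← Finset.mul_prod_erase _ _ (Finset.mem_univ i),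
      ← Finset.mul_prod_erase _ (fun j => x j ^ α j) (Finset.mem_univ i), ← neg_mul]
    congr 1
    · simp [he, hi.neg_pow]
    · exact Finset.prod_congr rfl fun j hj => by simp [he, Finset.ne_of_mem_erase hj]
  have hmp := e.measurePreserving_toSphere
  have h := integral_map (μ := (volume : Measure (EuclideanSpace ℝ (Fin n))).toSphere)
    hmp.measurable.aemeasurable
    (f := fun ω : Metric.sphere (0 : EuclideanSpace ℝ (Fin n)) 1 =>
      ∏ j, ((ω : EuclideanSpace ℝ (Fin n)) j) ^ α j)
    (Continuous.aestronglyMeasurable (by fun_prop))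
  rw [hmp.map_eq] at h
  simp only [hflip, integral_neg] at h
  linarith

/-- Power series of the Fourier-Laplace transform of the surface measure of the unit sphere. -/
theorem hasSum_integral_sphere_exp {n : ℕ} (w : Fin n → ℂ) :
    HasSum
      (fun ν : Fin n → ℕ => (∏ i, w i ^ (2 * ν i) / (Nat.factorial (2 * ν i) : ℂ)) *
        ((∫ ω : Metric.sphere (0 : EuclideanSpace ℝ (Fin n)) 1,
            ∏ i, ((ω : EuclideanSpace ℝ (Fin n)) i) ^ (2 * ν i)
          ∂((volume : Measure (EuclideanSpace ℝ (Fin n))).toSphere) : ℝ) : ℂ))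
      (∫ ω : Metric.sphere (0 : EuclideanSpace ℝ (Fin n)) 1,
          Complex.exp (∑ i, w i * (ω : EuclideanSpace ℝ (Fin n)) i)
        ∂((volume : Measure (EuclideanSpace ℝ (Fin n))).toSphere)) := by
  have hexp (u : Fin n → ℂ) := summable_norm_and_hasSum_fin_prod
    (fun i => NormedSpace.norm_expSeries_div_summable (u i))
    (fun i => NormedSpace.expSeries_div_hasSum_exp (u i))
  have hcoord (ω : Metric.sphere (0 : EuclideanSpace ℝ (Fin n)) 1) (i : Fin n) :
      ‖(ω : EuclideanSpace ℝ (Fin n)) i‖ ≤ 1 := by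
    simpa using PiLp.norm_apply_le (ω : EuclideanSpace ℝ (Fin n)) i
  have hfull := hasSum_integral_of_dominated_convergence
    (μ := (volume : Measure (EuclideanSpace ℝ (Fin n))).toSphere)
    (F := fun (α : Fin n → ℕ) (ω : Metric.sphere (0 : EuclideanSpace ℝ (Fin n)) 1) =>
      ∏ i, (w i * (ω : EuclideanSpace ℝ (Fin n)) i) ^ α i / (Nat.factorial (α i) : ℂ))
    (f := fun ω => Complex.exp (∑ i, w i * (ω : EuclideanSpace ℝ (Fin n)) i))
    (fun α _ => ‖∏ i, w i ^ α i / (Nat.factorial (α i) : ℂ)‖)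
    (fun α => Continuous.aestronglyMeasurable (by fun_prop))
    (fun α => .of_forall fun ω => by
      simp only [norm_prod, norm_div, norm_pow, norm_mul]
      gcongr with i
      exact mul_le_of_le_one_right (norm_nonneg _) (by simpa using hcoord ω i))
    (.of_forall fun _ => (hexp w).1)
    (integrable_const _)
    (.of_forall fun ω => by
      simpa only [Complex.exp_eq_exp_ℂ, NormedSpace.exp_sum] using
        (hexp fun i => w i * (ω : EuclideanSpace ℝ (Fin n)) i).2)
  have hterm (α : Fin n → ℕ) :
      ∫ ω : Metric.sphere (0 : EuclideanSpace ℝ (Fin n)) 1,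
          ∏ i, (w i * (ω : EuclideanSpace ℝ (Fin n)) i) ^ α i / (Nat.factorial (α i) : ℂ)
        ∂((volume : Measure (EuclideanSpace ℝ (Fin n))).toSphere) =
      (∏ i, w i ^ α i / (Nat.factorial (α i) : ℂ)) *
        ((∫ ω : Metric.sphere (0 : EuclideanSpace ℝ (Fin n)) 1,
            ∏ i, ((ω : EuclideanSpace ℝ (Fin n)) i) ^ α i
          ∂((volume : Measure (EuclideanSpace ℝ (Fin n))).toSphere) : ℝ) : ℂ) := by
    rw [← integral_complex_ofReal, ← integral_const_mul]
    congr 1 with ω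
    push_cast
    rw [← Finset.prod_mul_distrib]
    exact Finset.prod_congr rfl fun i _ => by ring
  simp only [hterm] at hfull
  have hinj : Function.Injective fun (ν : Fin n → ℕ) i => 2 * ν i := fun ν ν' h =>
    funext fun i => by simpa using congrFun h i
  refine (hinj.hasSum_iff fun α hα => ?_).mpr hfull
  have hodd : ∃ i, Odd (α i) := by
    by_contra! h
    refine hα ⟨fun i => α i / 2, funext fun i => ?_⟩
    exact Nat.two_mul_div_two_of_even (Nat.not_odd_iff_even.mp (h i))
  obtain ⟨i, hi⟩ := hodd
  rw [integral_sphere_monomial_eq_zero hi, Complex.ofReal_zero, mul_zero]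

/-- Taylor expansion of the Bargmann transform of the surface measure on `ρ S^{n-1}`:
`2^{-n/2}π^{-3n/4} e^{-z²/4} ∫_{ρS^{n-1}} e^{z·x-|x|²/2} dσ(x)
  = 2^{-n/2}π^{-3n/4} ρ^{n-1} e^{-ρ²/2} e^{-z²/4} Σ_ν ρ^{2|ν|} M(ν)/(2ν)! · z^{2ν}`. -/
theorem bargmann_sphere_measure (n : ℕ) (hn : 1 ≤ n) (ρ : ℝ) (hρ : 0 < ρ)
    (z : Fin n → ℂ) :
    HasSum
      (fun ν : Fin n → ℕ =>
        (((2 : ℝ) ^ (-(n : ℝ) / 2) * Real.pi ^ (-(3 * (n : ℝ)) / 4) *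
            ρ ^ (n - 1) * Real.exp (-ρ ^ 2 / 2) : ℝ) : ℂ) *
          Complex.exp (-(∑ i, (z i) ^ 2) / 4) *
          ((ρ ^ (2 * ∑ i, ν i) : ℝ) : ℂ) *
          (((∫ ω : Metric.sphere (0 : EuclideanSpace ℝ (Fin n)) 1,
                ∏ i, ((ω : EuclideanSpace ℝ (Fin n)) i) ^ (2 * ν i)
              ∂((volume : Measure (EuclideanSpace ℝ (Fin n))).toSphere)) : ℝ) : ℂ) /
          (∏ i, (Nat.factorial (2 * ν i) : ℂ)) *
          ∏ i, z i ^ (2 * ν i))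
      ((((2 : ℝ) ^ (-(n : ℝ) / 2) * Real.pi ^ (-(3 * (n : ℝ)) / 4) : ℝ) : ℂ) *
        Complex.exp (-(∑ i, (z i) ^ 2) / 4) *
        sphereSurfaceIntegral n ρ
          (fun x => Complex.exp ((∑ i, z i * x i) - (‖x‖ : ℂ) ^ 2 / 2))) := by
  have hsphere : sphereSurfaceIntegral n ρ
      (fun x => Complex.exp ((∑ i, z i * x i) - (‖x‖ : ℂ) ^ 2 / 2)) =
      (ρ : ℂ) ^ (n - 1) * (Complex.exp (-(ρ : ℂ) ^ 2 / 2) *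
        ∫ ω : Metric.sphere (0 : EuclideanSpace ℝ (Fin n)) 1,
          Complex.exp (∑ i, (ρ * z i) * (ω : EuclideanSpace ℝ (Fin n)) i)
        ∂((volume : Measure (EuclideanSpace ℝ (Fin n))).toSphere)) := by
    rw [sphereSurfaceIntegral]
    congr 1
    rw [← integral_const_mul]
    congr 1
    funext ω
    rw [← Complex.exp_add, norm_smul, norm_eq_of_mem_sphere, mul_one, Real.norm_of_nonneg hρ.le,
      sub_eq_neg_add, neg_div]
    congr 2
    refine Finset.sum_congr rfl fun i _ => ?_
    rw [PiLp.smul_apply, smul_eq_mul, Complex.ofReal_mul]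
    ring
  rw [hsphere, ← mul_assoc, ← mul_assoc]
  convert! (hasSum_integral_sphere_exp fun i => ρ * z i).mul_left _ using 1
  funext ν
  simp only [mul_pow, Finset.prod_div_distrib, Finset.prod_mul_distrib, Finset.prod_pow_eq_pow_sum,
    ← Finset.mul_sum]
  push_cast
  ring
end

section
/- For every z ∈ ℂⁿ and every complex λ with Re(λ) > -n, ∫_{ℝⁿ} e^{z·x - |x|²/2} |x|^λ dx = Σ_ν (M(ν) 2^{|ν| + (λ+n)/2 - 1} Γ(|ν| + (λ+n)/2) / (2ν)!) z^{2ν}, where M(ν) = ∫_{S^{n-1}} ω^{2ν} dσ(ω) and the sum is over all multi-indices ν ∈ (ℕ∪{0})ⁿ. -/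
open MeasureTheory

open Set in
/-- Integration in polar coordinates of a function which splits into an angular and a radial
factor. -/
theorem integral_eq_integral_toSphere_mul_integral_Ioi {E : Type*} [NormedAddCommGroup E]
    [NormedSpace ℝ E] [FiniteDimensional ℝ E] [Nontrivial E] [MeasurableSpace E] [BorelSpace E]
    (μ : Measure E) [μ.IsAddHaarMeasure] (f : E → ℂ) (g : Metric.sphere (0 : E) 1 → ℂ) (h : ℝ → ℂ)
    (hf : ∀ (ω : Metric.sphere (0 : E) 1) (r : ℝ), 0 < r → f (r • (ω : E)) = g ω * h r) :
    ∫ x, f x ∂μ = (∫ ω, g ω ∂μ.toSphere) *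
      ∫ r in Ioi (0 : ℝ), r ^ (Module.finrank ℝ E - 1) • h r :=
  calc
    ∫ x, f x ∂μ = ∫ x : ({(0)}ᶜ : Set E), f x.1 ∂(μ.comap (↑)) := by
      rw [integral_subtype_comap (measurableSet_singleton _).compl fun x ↦ f x,
        restrict_compl_singleton]
    _ = ∫ p, g p.1 * h p.2 ∂μ.toSphere.prod (.volumeIoiPow (Module.finrank ℝ E - 1)) := by
      rw [← μ.measurePreserving_homeomorphUnitSphereProd.integral_comp
        (Homeomorph.measurableEmbedding _)]
      refine integral_congr_ae (.of_forall fun x ↦ ?_)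
      have hx : 0 < ‖(x : E)‖ := norm_pos_iff.2 x.2
      simp only
      rw [homeomorphUnitSphereProd_apply_snd_coe, ← hf _ _ hx,
        homeomorphUnitSphereProd_apply_fst_coe, smul_inv_smul₀ hx.ne']
    _ = (∫ ω, g ω ∂μ.toSphere) *
        ∫ r : Ioi (0 : ℝ), h r ∂.volumeIoiPow (Module.finrank ℝ E - 1) :=
      integral_prod_mul g (fun r : Ioi (0 : ℝ) ↦ h r)
    _ = _ := by
      simp only [Measure.volumeIoiPow, ENNReal.ofReal]
      rw [integral_withDensity_eq_integral_smul,
        integral_subtype_comap measurableSet_Ioi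
          fun a ↦ Real.toNNReal (a ^ (Module.finrank ℝ E - 1)) • h a,
        setIntegral_congr_fun measurableSet_Ioi fun x hx ↦ ?_]
      · rw [NNReal.smul_def, Real.coe_toNNReal _ (pow_nonneg hx.out.le _)]
      · exact (measurable_subtype_coe.pow_const _).real_toNNReal

/-- A finite product of absolutely convergent series is the absolutely convergent multiple
series of the products of the terms. -/
theorem summable_norm_and_hasSum_pi_prod {ι R : Type*} [NormedCommRing R] [CompleteSpace R]
    {n : ℕ} {f : Fin n → ι → R} {a : Fin n → R} (hs : ∀ i, Summable fun k ↦ ‖f i k‖)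
    (ha : ∀ i, HasSum (f i) (a i)) :
    (Summable fun ν : Fin n → ι ↦ ‖∏ i, f i (ν i)‖) ∧
      HasSum (fun ν : Fin n → ι ↦ ∏ i, f i (ν i)) (∏ i, a i) := by
  induction n with
  | zero => exact ⟨.of_finite, by simp⟩
  | succ n ih =>
    obtain ⟨hs', ha'⟩ := ih (f := fun i ↦ f i.succ) (fun i ↦ hs i.succ) (fun i ↦ ha i.succ)
    have hn := (hs 0).mul_norm hs'
    let e : ι × (Fin n → ι) ≃ (Fin (n + 1) → ι) := Fin.consEquiv fun _ ↦ ι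
    have he (p : ι × (Fin n → ι)) :
        ∏ i, f i (e p i) = f 0 p.1 * ∏ i : Fin n, f i.succ (p.2 i) :=
      Fin.prod_univ_succ _
    rw [← e.summable_iff, ← e.hasSum_iff, Fin.prod_univ_succ]
    simp only [Function.comp_def, he]
    have hn' := hn.of_norm
    have hsum := (ha 0).mul ha' hn'
    exact ⟨hn, hsum⟩

/-- The moments of a Gaussian on the half-line. -/
theorem integral_cpow_mul_exp_neg_sq_div_two {s : ℂ} (hs : 0 < s.re) :
    ∫ r in Set.Ioi (0 : ℝ), (r : ℂ) ^ (s - 1) * Complex.exp (-(r : ℂ) ^ 2 / 2) =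
      2 ^ (s / 2 - 1) * Complex.Gamma (s / 2) := by
  have h := mellin_comp_rpow (fun t : ℝ ↦ Complex.exp (-((1 / 2 : ℝ) * t))) s 2
  have hs2 : 0 < (s / 2).re := by
    rw [Complex.div_ofNat_re]; positivity
  simp only [mellin, smul_eq_mul, Complex.ofReal_ofNat] at h
  rw [Complex.integral_cpow_mul_exp_neg_mul_Ioi hs2 (by norm_num)] at h
  calc
    _ = _ := by
      refine integral_congr_ae (.of_forall fun r ↦ ?_)
      simp only [Real.rpow_ofNat, Complex.ofReal_pow]
      congr 2
      push_cast
      ring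
    _ = _ := h
    _ = _ := by
      rw [Complex.cpow_sub _ _ two_ne_zero, Complex.cpow_one]
      norm_num [Complex.real_smul]
      ring

/-- A function on `ℝⁿ` which is odd in one coordinate has vanishing integral. -/
theorem integral_eq_zero_of_odd_coordinate {n : ℕ} (i : Fin n) (f : EuclideanSpace ℝ (Fin n) → ℂ)
    (hf : ∀ x, f (LinearIsometryEquiv.piLpCongrRight 2
      (fun j ↦ if j = i then LinearIsometryEquiv.neg ℝ else .refl ℝ ℝ) x) = -f x) :
    ∫ x, f x = 0 := by
  let e : EuclideanSpace ℝ (Fin n) ≃ₗᵢ[ℝ] EuclideanSpace ℝ (Fin n) :=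
    LinearIsometryEquiv.piLpCongrRight 2
      (fun j ↦ if j = i then LinearIsometryEquiv.neg ℝ else .refl ℝ ℝ)
  have h := e.measurePreserving.integral_comp e.toHomeomorph.measurableEmbedding f
  simp only [e, hf, integral_neg] at h
  exact self_eq_neg.1 h.symm

/-- The power weight times a Gaussian times an exponential in the norm is integrable. -/
theorem integrable_norm_rpow_mul_exp {n : ℕ} (hn : 1 ≤ n) {s : ℝ} (hs : -(n : ℝ) < s) :
    Integrable fun x : EuclideanSpace ℝ (Fin n) ↦
      ‖x‖ ^ s * Real.exp (-(1 / 4) * ‖x‖ ^ 2) := by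
  have : NeZero n := ⟨by omega⟩
  rw [integrable_fun_norm_addHaar volume (f := fun r ↦ r ^ s * Real.exp (-(1 / 4) * r ^ 2))]
  rw [finrank_euclideanSpace_fin]
  refine (integrableOn_rpow_mul_exp_neg_mul_sq (b := 1 / 4) (by norm_num)
    (s := (n - 1 : ℕ) + s) ?_).congr_fun (fun r hr ↦ ?_) measurableSet_Ioi
  · rw [Nat.cast_sub hn]; push_cast; linarith
  · simp only [smul_eq_mul]
    rw [Real.rpow_add hr, Real.rpow_natCast, mul_assoc]

theorem integrable_exp_mul_norm_exp_mul_norm_cpow {n : ℕ} (hn : 1 ≤ n) {lam : ℂ}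
    (hlam : -(n : ℝ) < lam.re) (z : Fin n → ℂ) :
    Integrable fun x : EuclideanSpace ℝ (Fin n) ↦ Real.exp (∑ i, ‖z i * x i‖) *
      ‖Complex.exp (-(‖x‖ : ℂ) ^ 2 / 2) * (‖x‖ : ℂ) ^ lam‖ := by
  have : NeZero n := ⟨by omega⟩
  refine ((integrable_norm_rpow_mul_exp hn hlam).const_mul
    (Real.exp ((∑ i, ‖z i‖) ^ 2))).mono' (by fun_prop) ?_
  filter_upwards [Measure.ae_ne volume 0] with x hx
  have hx : 0 < ‖x‖ := norm_pos_iff.2 hx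
  have hsum : ∑ i, ‖z i * x i‖ ≤ (∑ i, ‖z i‖) * ‖x‖ := by
    rw [Finset.sum_mul]
    gcongr with i
    rw [norm_mul, Complex.norm_real]
    gcongr
    exact PiLp.norm_apply_le x i
  have hexp : ‖Complex.exp (-(‖x‖ : ℂ) ^ 2 / 2)‖ = Real.exp (-‖x‖ ^ 2 / 2) := by
    rw [Complex.norm_exp]; norm_cast
  rw [Real.norm_of_nonneg (by positivity), norm_mul, hexp,
    Complex.norm_cpow_eq_rpow_re_of_pos hx, ← mul_assoc, ← Real.exp_add, mul_left_comm,
    ← Real.exp_add, mul_comm]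
  refine mul_le_mul_of_nonneg_left (Real.exp_le_exp.2 ?_) (by positivity)
  nlinarith [sq_nonneg (‖x‖ / 2 - ∑ i, ‖z i‖)]

/-- The multivariate exponential series of the integral, before discarding the vanishing terms. -/
theorem hasSum_integral_exp_norm_cpow {n : ℕ} (hn : 1 ≤ n) {lam : ℂ}
    (hlam : -(n : ℝ) < lam.re) (z : Fin n → ℂ) :
    HasSum
      (fun α : Fin n → ℕ ↦ ∫ x : EuclideanSpace ℝ (Fin n),
        (∏ i, (z i * x i) ^ α i / (α i).factorial) *
          (Complex.exp (-(‖x‖ : ℂ) ^ 2 / 2) * (‖x‖ : ℂ) ^ lam))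
      (∫ x : EuclideanSpace ℝ (Fin n),
        Complex.exp ((∑ i, z i * x i) - (‖x‖ : ℂ) ^ 2 / 2) * (‖x‖ : ℂ) ^ lam) := by
  have hexp (x : EuclideanSpace ℝ (Fin n)) := summable_norm_and_hasSum_pi_prod
    (f := fun i (k : ℕ) ↦ (z i * x i) ^ k / (k.factorial : ℂ)) (a := fun i ↦ Complex.exp (z i * x i))
    (fun i ↦ NormedSpace.norm_expSeries_div_summable (z i * x i : ℂ))
    (fun i ↦ by
      rw [Complex.exp_eq_exp_ℂ]; exact NormedSpace.expSeries_div_hasSum_exp (z i * x i : ℂ))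
  have hnorm (x : EuclideanSpace ℝ (Fin n)) := (summable_norm_and_hasSum_pi_prod
    (f := fun i (k : ℕ) ↦ ‖z i * x i‖ ^ k / (k.factorial : ℝ)) (a := fun i ↦ Real.exp ‖z i * x i‖)
    (fun i ↦ NormedSpace.norm_expSeries_div_summable ‖z i * x i‖)
    (fun i ↦ by
      rw [Real.exp_eq_exp_ℝ]; exact NormedSpace.expSeries_div_hasSum_exp ‖z i * x i‖)).2.mul_right
        ‖Complex.exp (-(‖x‖ : ℂ) ^ 2 / 2) * (‖x‖ : ℂ) ^ lam‖
  simp only [← Real.exp_sum] at hnorm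
  refine hasSum_integral_of_dominated_convergence
    (fun α x ↦ (∏ i, ‖z i * x i‖ ^ α i / ((α i).factorial : ℝ)) *
      ‖Complex.exp (-(‖x‖ : ℂ) ^ 2 / 2) * (‖x‖ : ℂ) ^ lam‖)
    (fun α ↦ by fun_prop) (fun α ↦ .of_forall fun x ↦ ?_) (.of_forall fun x ↦ (hnorm x).summable)
    ?_ (.of_forall fun x ↦ ?_)
  · simp [norm_prod]
  · simp only [(hnorm _).tsum_eq]
    exact integrable_exp_mul_norm_exp_mul_norm_cpow hn hlam z
  · convert! (hexp x).2.mul_right (Complex.exp (-(‖x‖ : ℂ) ^ 2 / 2) * (‖x‖ : ℂ) ^ lam) using 1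
    rw [← Complex.exp_sum, ← mul_assoc, ← Complex.exp_add, neg_div, sub_eq_add_neg]

theorem integral_monomial_mul_gaussian_eq_zero {n : ℕ} (lam : ℂ) (z : Fin n → ℂ)
    {α : Fin n → ℕ} {i : Fin n} (hi : Odd (α i)) :
    ∫ x : EuclideanSpace ℝ (Fin n), (∏ i, (z i * x i) ^ α i / (α i).factorial) *
      (Complex.exp (-(‖x‖ : ℂ) ^ 2 / 2) * (‖x‖ : ℂ) ^ lam) = 0 := by
  refine integral_eq_zero_of_odd_coordinate i _ fun x ↦ ?_
  rw [LinearIsometryEquiv.norm_map, ← neg_mul]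
  congr 1
  rw [← Finset.mul_prod_erase _ _ (Finset.mem_univ i),
    ← Finset.mul_prod_erase _ _ (Finset.mem_univ i), ← neg_mul]
  congr 1
  · simp [hi.neg_pow, neg_div]
  · refine Finset.prod_congr rfl fun j hj ↦ ?_
    simp [Finset.ne_of_mem_erase hj]

theorem integral_even_monomial_mul_gaussian {n : ℕ} (hn : 1 ≤ n) {lam : ℂ}
    (hlam : -(n : ℝ) < lam.re) (z : Fin n → ℂ) (ν : Fin n → ℕ) :
    ∫ x : EuclideanSpace ℝ (Fin n), (∏ i, (z i * x i) ^ (2 * ν i) / (2 * ν i).factorial) *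
      (Complex.exp (-(‖x‖ : ℂ) ^ 2 / 2) * (‖x‖ : ℂ) ^ lam) =
    (((∫ ω : Metric.sphere (0 : EuclideanSpace ℝ (Fin n)) 1,
          ∏ i, ((ω : EuclideanSpace ℝ (Fin n)) i) ^ (2 * ν i)
        ∂((volume : Measure (EuclideanSpace ℝ (Fin n))).toSphere)) : ℝ) : ℂ) *
      (2 : ℂ) ^ (((∑ i, ν i : ℕ) : ℂ) + (lam + n) / 2 - 1) *
      Complex.Gamma (((∑ i, ν i : ℕ) : ℂ) + (lam + n) / 2) /
      (∏ i, (Nat.factorial (2 * ν i) : ℂ)) *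
      ∏ i, z i ^ (2 * ν i) := by
  have : NeZero n := ⟨by omega⟩
  rw [integral_eq_integral_toSphere_mul_integral_Ioi volume _
    (fun ω ↦ ((∏ i, z i ^ (2 * ν i)) / ∏ i, (Nat.factorial (2 * ν i) : ℂ)) *
      ((∏ i, ((ω : EuclideanSpace ℝ (Fin n)) i) ^ (2 * ν i) : ℝ) : ℂ))
    (fun r ↦ (r : ℂ) ^ (2 * ∑ i, ν i) * (Complex.exp (-(r : ℂ) ^ 2 / 2) * (r : ℂ) ^ lam)),
    integral_const_mul, integral_complex_ofReal, finrank_euclideanSpace_fin]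
  · have hs : 0 < (2 * ((∑ i, ν i : ℕ) : ℂ) + (lam + n)).re := by
      have : (0 : ℝ) ≤ (∑ i, ν i : ℕ) := Nat.cast_nonneg _
      simp only [Complex.add_re, Complex.mul_re, Complex.re_ofNat, Complex.im_ofNat,
        Complex.natCast_re, Complex.natCast_im]
      linarith
    have h := integral_cpow_mul_exp_neg_sq_div_two hs
    rw [add_div, mul_div_cancel_left₀ _ two_ne_zero] at h
    rw [mul_assoc _ ((2 : ℂ) ^ _), ← h]
    rw [setIntegral_congr_fun (g := fun r : ℝ ↦ (r : ℂ) ^ (2 * ((∑ i, ν i : ℕ) : ℂ) + (lam + n) - 1)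
      * Complex.exp (-(r : ℂ) ^ 2 / 2)) measurableSet_Ioi fun r hr ↦ ?_]
    · ring
    · have hr : (r : ℂ) ≠ 0 := Complex.ofReal_ne_zero.2 (ne_of_gt hr)
      have he : 2 * ((∑ i, ν i : ℕ) : ℂ) + (lam + n) - 1 =
          ((n - 1 : ℕ) : ℂ) + ((2 * ∑ i, ν i : ℕ) : ℂ) + lam := by
        rw [Nat.cast_sub hn]; push_cast; ring
      simp only [Complex.real_smul, Complex.ofReal_pow]
      rw [he, Complex.cpow_add _ _ hr, Complex.cpow_add _ _ hr, Complex.cpow_natCast,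
        Complex.cpow_natCast]
      ring
  · intro ω r hr
    have hω : ‖r • (ω : EuclideanSpace ℝ (Fin n))‖ = r := by
      rw [norm_smul, Real.norm_of_nonneg hr.le, norm_eq_of_mem_sphere, mul_one]
    rw [hω, ← mul_assoc, Finset.mul_sum, ← Finset.prod_pow_eq_pow_sum]
    simp only [PiLp.smul_apply, smul_eq_mul, Complex.ofReal_mul, mul_pow, Complex.ofReal_prod,
      Complex.ofReal_pow, Finset.prod_mul_distrib, Finset.prod_div_distrib]
    ring

/-- For `Re λ > -n`,
`∫_{ℝⁿ} e^{z·x-|x|²/2} |x|^λ dx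
  = Σ_ν M(ν) 2^{|ν|+(λ+n)/2-1} Γ(|ν|+(λ+n)/2)/(2ν)! · z^{2ν}`,
where `M(ν) = ∫_{S^{n-1}} ω^{2ν} dσ(ω)`. -/
theorem integral_exp_norm_pow_expansion (n : ℕ) (hn : 1 ≤ n) (lam : ℂ)
    (hlam : -(n : ℝ) < lam.re) (z : Fin n → ℂ) :
    HasSum
      (fun ν : Fin n → ℕ =>
        (((∫ ω : Metric.sphere (0 : EuclideanSpace ℝ (Fin n)) 1,
              ∏ i, ((ω : EuclideanSpace ℝ (Fin n)) i) ^ (2 * ν i)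
            ∂((volume : Measure (EuclideanSpace ℝ (Fin n))).toSphere)) : ℝ) : ℂ) *
          (2 : ℂ) ^ (((∑ i, ν i : ℕ) : ℂ) + (lam + n) / 2 - 1) *
          Complex.Gamma (((∑ i, ν i : ℕ) : ℂ) + (lam + n) / 2) /
          (∏ i, (Nat.factorial (2 * ν i) : ℂ)) *
          ∏ i, z i ^ (2 * ν i))
      (∫ x : EuclideanSpace ℝ (Fin n),
        Complex.exp ((∑ i, z i * x i) - (‖x‖ : ℂ) ^ 2 / 2) * (‖x‖ : ℂ) ^ lam) := by
  have hinj : Function.Injective fun (ν : Fin n → ℕ) i ↦ 2 * ν i := fun ν ν' h ↦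
    funext fun i ↦ Nat.eq_of_mul_eq_mul_left two_pos (congrFun h i)
  have h := (hinj.hasSum_iff fun α hα ↦ ?_).2 (hasSum_integral_exp_norm_cpow hn hlam z)
  · simpa only [Function.comp_def, integral_even_monomial_mul_gaussian hn hlam] using h
  · have : ∃ i, Odd (α i) := by
      by_contra! heven
      simp only [Nat.not_odd_iff_even] at heven
      exact hα ⟨fun i ↦ α i / 2, funext fun i ↦ Nat.two_mul_div_two_of_even (heven i)⟩
    obtain ⟨i, hi⟩ := this
    exact integral_monomial_mul_gaussian_eq_zero lam z hi
end

section
/- Let {a_α} be a family of complex numbers indexed by multi-indices α ∈ (ℕ∪{0})ⁿ such that Σ_α |a_α|² (1+|α|)^m < ∞ for every nonnegative integer m. Then the series Σ_α a_α h_α converges in the Schwartz space 𝒮(ℝⁿ). -/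
open MeasureTheory SchwartzMap

/-- The `k`-th Hermite function
`h_k(t) = ((-1)^k/(π^{1/4} 2^{k/2} (k!)^{1/2})) e^{t²/2} (d/dt)^k e^{-t²}`. -/
noncomputable def hermiteFun (k : ℕ) (t : ℝ) : ℝ :=
  ((-1 : ℝ) ^ k /
      (Real.pi ^ ((1 : ℝ) / 4) * (2 : ℝ) ^ ((k : ℝ) / 2) *
        Real.sqrt (Nat.factorial k))) *
    Real.exp (t ^ 2 / 2) * iteratedDeriv k (fun s : ℝ => Real.exp (-s ^ 2)) t

/-- A family of Schwartz functions all of whose Schwartz seminorms are summable is summable. -/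
theorem SchwartzMap.summable_of_summable_seminorm {𝕜 ι E F : Type*} [RCLike 𝕜]
    [NormedAddCommGroup E] [NormedSpace ℝ E] [NormedAddCommGroup F] [NormedSpace ℝ F]
    [NormedSpace 𝕜 F] [SMulCommClass ℝ 𝕜 F] [CompleteSpace F] (f : ι → 𝓢(E, F))
    (hf : ∀ k l : ℕ, Summable fun i => SchwartzMap.seminorm 𝕜 k l (f i)) : Summable f := by
  have hsm : ∀ i, ContDiff ℝ (⊤ : ℕ∞) (f i) := fun i => (f i).smooth _
  have hbd : ∀ (l : ℕ) (i : ι) (x : E), (l : ℕ∞) ≤ ⊤ →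
      ‖iteratedFDeriv ℝ l (f i) x‖ ≤ SchwartzMap.seminorm 𝕜 0 l (f i) :=
    fun l i x _ => (f i).norm_iteratedFDeriv_le_seminorm 𝕜 l x
  have hv : ∀ l : ℕ, (l : ℕ∞) ≤ ⊤ → Summable fun i => SchwartzMap.seminorm 𝕜 0 l (f i) :=
    fun l _ => hf 0 l
  have hder : ∀ (l : ℕ) (x : E), iteratedFDeriv ℝ l (fun y => ∑' i, f i y) x =
      ∑' i, iteratedFDeriv ℝ l (f i) x :=
    fun l x => iteratedFDeriv_tsum_apply hsm hv hbd le_top x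
  have hsum : ∀ (l : ℕ) (x : E), Summable fun i => iteratedFDeriv ℝ l (f i) x :=
    fun l x => Summable.of_norm_bounded (hf 0 l) fun i => hbd l i x le_top
  have hle : ∀ (k l : ℕ) (x : E) (i : ι),
      ‖x‖ ^ k * ‖iteratedFDeriv ℝ l (f i) x‖ ≤ SchwartzMap.seminorm 𝕜 k l (f i) :=
    fun k l x i => (f i).le_seminorm 𝕜 k l x
  have hnorm : ∀ (k l : ℕ) (x : E),
      ‖x‖ ^ k * ‖iteratedFDeriv ℝ l (fun y => ∑' i, f i y) x‖ ≤
        ∑' i, SchwartzMap.seminorm 𝕜 k l (f i) := fun k l x => by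
    have hs : Summable fun i => ‖iteratedFDeriv ℝ l (f i) x‖ :=
      Summable.of_nonneg_of_le (fun _ => norm_nonneg _) (fun i => hbd l i x le_top) (hf 0 l)
    rw [hder]
    calc ‖x‖ ^ k * ‖∑' i, iteratedFDeriv ℝ l (f i) x‖
        ≤ ‖x‖ ^ k * ∑' i, ‖iteratedFDeriv ℝ l (f i) x‖ := by
          gcongr; exact norm_tsum_le_tsum_norm hs
      _ = ∑' i, ‖x‖ ^ k * ‖iteratedFDeriv ℝ l (f i) x‖ := by rw [tsum_mul_left]
      _ ≤ _ := (hs.mul_left _).tsum_le_tsum (hle k l x) (hf k l)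
  let g : 𝓢(E, F) :=
    { toFun := fun y => ∑' i, f i y
      smooth' := contDiff_tsum hsm hv hbd
      decay' := fun k l => ⟨_, hnorm k l⟩ }
  refine ⟨g, ((schwartz_withSeminorms 𝕜 E F).tendsto_nhds _ _).2 ?_⟩
  rintro ⟨k, l⟩ ε hε
  filter_upwards [(tendsto_order.1
    (tendsto_tsum_compl_atTop_zero fun i => SchwartzMap.seminorm 𝕜 k l (f i))).2 ε hε] with s hs
  refine lt_of_le_of_lt ?_ hs
  refine SchwartzMap.seminorm_le_bound 𝕜 k l _ (tsum_nonneg fun _ => apply_nonneg _ _) fun x => ?_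
  have hsx : iteratedFDeriv ℝ l (⇑(∑ i ∈ s, f i - g)) x =
      -∑' i : {i // i ∉ s}, iteratedFDeriv ℝ l (f i) x := by
    have h1 : (⇑(∑ i ∈ s, f i - g) : E → F) = (∑ i ∈ s, ⇑(f i)) - ⇑g := by
      ext y; simp
    have hg : iteratedFDeriv ℝ l (⇑g) x = _ := (hder l x).trans
      ((hsum l x).sum_add_tsum_subtype_compl s).symm
    rw [h1, iteratedFDeriv_sub_apply _ (g.contDiffAt l), iteratedFDeriv_sum_apply, hg,
      sub_add_cancel_left]
    · exact fun i _ => (f i).contDiffAt l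
    · rw [Finset.sum_fn]
      exact ContDiffAt.sum fun i _ => (f i).contDiffAt l
  have hs' : Summable fun i : {i // i ∉ s} => ‖iteratedFDeriv ℝ l (f i) x‖ :=
    Summable.of_nonneg_of_le (fun _ => norm_nonneg _) (fun i => hbd l i x le_top)
      ((hf 0 l).subtype _)
  rw [hsx, norm_neg]
  calc ‖x‖ ^ k * ‖∑' i : {i // i ∉ s}, iteratedFDeriv ℝ l (f i) x‖
      ≤ ‖x‖ ^ k * ∑' i : {i // i ∉ s}, ‖iteratedFDeriv ℝ l (f i) x‖ := by
        gcongr; exact norm_tsum_le_tsum_norm hs'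
    _ = ∑' i : {i // i ∉ s}, ‖x‖ ^ k * ‖iteratedFDeriv ℝ l (f i) x‖ := by rw [tsum_mul_left]
    _ ≤ _ := (hs'.mul_left _).tsum_le_tsum (fun i => hle k l x i) ((hf k l).subtype _)

/-- The sum `∑_α (1 + |α|)^(-2n)` over `α ∈ ℕⁿ` is finite. -/
theorem summable_inv_one_add_sum_pow (n : ℕ) :
    Summable fun α : Fin n → ℕ => ((1 + ∑ i, (α i : ℝ)) ^ (2 * n))⁻¹ := by
  have h1 : Summable fun k : ℕ => ((1 + (k : ℝ)) ^ 2)⁻¹ := by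
    have := (summable_nat_add_iff 1).2 (Real.summable_nat_pow_inv.2 (one_lt_two))
    simpa [add_comm] using this
  have h2 : Summable fun α : Fin n → ℕ => ∏ i, ((1 + (α i : ℝ)) ^ 2)⁻¹ := by
    refine summable_of_sum_le (c := ∏ _i : Fin n, ∑' k : ℕ, ((1 + (k : ℝ)) ^ 2)⁻¹)
      (fun α => by positivity) fun u => ?_
    calc ∑ α ∈ u, ∏ i, ((1 + (α i : ℝ)) ^ 2)⁻¹
        ≤ ∑ α ∈ Fintype.piFinset fun i => u.image fun α : Fin n → ℕ => α i,
            ∏ i, ((1 + (α i : ℝ)) ^ 2)⁻¹ := by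
          refine Finset.sum_le_sum_of_subset_of_nonneg (fun α hα => ?_)
            fun _ _ _ => by positivity
          exact Fintype.mem_piFinset.2 fun i => Finset.mem_image_of_mem _ hα
      _ = ∏ i, ∑ k ∈ u.image fun α : Fin n → ℕ => α i, ((1 + (k : ℝ)) ^ 2)⁻¹ :=
          (Finset.prod_univ_sum _ fun _ (k : ℕ) => ((1 + (k : ℝ)) ^ 2)⁻¹).symm
      _ ≤ _ := Finset.prod_le_prod (fun _ _ => by positivity) fun i _ =>
          h1.sum_le_tsum _ fun _ _ => by positivity
  refine Summable.of_nonneg_of_le (fun α => by positivity) (fun α => ?_) h2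
  rw [Finset.prod_inv_distrib]
  refine inv_anti₀ (by positivity) ?_
  calc ∏ i, (1 + (α i : ℝ)) ^ 2 ≤ ∏ _i : Fin n, (1 + ∑ i, (α i : ℝ)) ^ 2 := by
        gcongr with i
        exact Finset.single_le_sum (f := fun i => (α i : ℝ)) (fun _ _ => by positivity)
          (Finset.mem_univ i)
    _ = _ := by simp [pow_mul]

theorem contDiff_exp_neg_sq : ContDiff ℝ (⊤ : ℕ∞) fun s : ℝ => Real.exp (-s ^ 2) := by
  fun_prop

theorem hasDerivAt_iteratedDeriv_exp_neg_sq (k : ℕ) (t : ℝ) :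
    HasDerivAt (iteratedDeriv k fun s : ℝ => Real.exp (-s ^ 2))
      (iteratedDeriv (k + 1) (fun s : ℝ => Real.exp (-s ^ 2)) t) t := by
  rw [iteratedDeriv_succ]
  refine DifferentiableAt.hasDerivAt ?_
  exact contDiff_exp_neg_sq.differentiable_iteratedDeriv k (mod_cast WithTop.coe_lt_top k) t

/-- The three-term recurrence for the derivatives of the Gaussian. -/
theorem iteratedDeriv_succ_exp_neg_sq (k : ℕ) (t : ℝ) :
    iteratedDeriv (k + 1) (fun s : ℝ => Real.exp (-s ^ 2)) t =
      -2 * t * iteratedDeriv k (fun s : ℝ => Real.exp (-s ^ 2)) t -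
        2 * k * iteratedDeriv (k - 1) (fun s : ℝ => Real.exp (-s ^ 2)) t := by
  induction k generalizing t with
  | zero =>
    have : HasDerivAt (fun s : ℝ => Real.exp (-s ^ 2)) (Real.exp (-t ^ 2) * -(2 * t)) t := by
      simpa using ((hasDerivAt_pow 2 t).neg).exp
    simp only [zero_add, iteratedDeriv_one, iteratedDeriv_zero, this.deriv]
    simp; ring
  | succ k ih =>
    have h1 := hasDerivAt_iteratedDeriv_exp_neg_sq (k + 1) t
    rw [funext ih] at h1
    have h2 := (((hasDerivAt_id t).const_mul (-2)).mul
      (hasDerivAt_iteratedDeriv_exp_neg_sq k t)).sub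
      ((hasDerivAt_iteratedDeriv_exp_neg_sq (k - 1) t).const_mul (2 * (k : ℝ)))
    have h3 := h1.unique h2
    rw [h3]
    rcases k with _ | k
    · simp; ring
    · simp; ring

theorem iteratedDeriv_cexp_neg_sq_ofReal (k : ℕ) (t : ℝ) :
    iteratedDeriv k (fun z : ℂ => Complex.exp (-z ^ 2)) t =
      (iteratedDeriv k (fun s : ℝ => Real.exp (-s ^ 2)) t : ℝ) := by
  induction k generalizing t with
  | zero => simp
  | succ k ih =>
    have hc : ContDiff ℂ (⊤ : ℕ∞) fun z : ℂ => Complex.exp (-z ^ 2) := by fun_prop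
    have h1 := (hc.differentiable_iteratedDeriv k
      (mod_cast WithTop.coe_lt_top k) (t : ℂ)).hasDerivAt.comp_ofReal
    rw [← iteratedDeriv_succ, funext ih] at h1
    exact h1.unique (hasDerivAt_iteratedDeriv_exp_neg_sq k t).ofReal_comp

theorem abs_iteratedDeriv_exp_neg_sq_le (k : ℕ) (t : ℝ) {r : ℝ} (hr : 0 < r) :
    Real.exp (t ^ 2 / 2) * |iteratedDeriv k (fun s : ℝ => Real.exp (-s ^ 2)) t| ≤
      k.factorial * Real.exp (r ^ 2) / r ^ k := by
  have hd : Differentiable ℂ fun z : ℂ => Complex.exp (-z ^ 2) := by fun_prop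
  have := Complex.norm_iteratedDeriv_le_of_forall_mem_sphere_norm_le (c := (t : ℂ))
    (C := Real.exp (r ^ 2 - t ^ 2 / 2)) k hr hd.diffContOnCl fun z hz => by
      rw [Complex.norm_exp, Real.exp_le_exp]
      have hz2 : (z.re - t) ^ 2 + z.im ^ 2 = r ^ 2 := by
        rw [mem_sphere_iff_norm] at hz
        rw [← hz, Complex.sq_norm, Complex.normSq_apply]
        simp; ring
      simp [pow_two]
      nlinarith [sq_nonneg (2 * z.re - t)]
  rw [iteratedDeriv_cexp_neg_sq_ofReal, Complex.norm_real, Real.norm_eq_abs] at this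
  calc _ ≤ Real.exp (t ^ 2 / 2) * (k.factorial * Real.exp (r ^ 2 - t ^ 2 / 2) / r ^ k) := by
        gcongr
    _ = k.factorial * (Real.exp (t ^ 2 / 2) * Real.exp (r ^ 2 - t ^ 2 / 2)) / r ^ k := by ring
    _ = _ := by rw [← Real.exp_add]; ring_nf

/-- The normalising constant of the `k`-th Hermite function. -/
noncomputable def hermiteConst (k : ℕ) : ℝ :=
  (-1 : ℝ) ^ k /
    (Real.pi ^ ((1 : ℝ) / 4) * (2 : ℝ) ^ ((k : ℝ) / 2) * Real.sqrt (Nat.factorial k))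

theorem sqrt_mul_hermiteConst_succ (k : ℕ) :
    √(2 * (k + 1)) * hermiteConst (k + 1) = -hermiteConst k := by
  have h2 : (2 : ℝ) ^ (((k + 1 : ℕ) : ℝ) / 2) = 2 ^ ((k : ℝ) / 2) * √2 := by
    rw [Real.sqrt_eq_rpow, ← Real.rpow_add two_pos]
    push_cast; ring_nf
  have h3 : √((k + 1).factorial : ℝ) = √((k : ℝ) + 1) * √(k.factorial : ℝ) := by
    rw [Nat.factorial_succ, ← Real.sqrt_mul (by positivity)]; push_cast; rfl
  have h4 : √((k : ℝ) + 1) ≠ 0 := by positivity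
  have h5 : √(k.factorial : ℝ) ≠ 0 := by positivity
  have h6 : Real.pi ^ ((1 : ℝ) / 4) ≠ 0 := by positivity
  have h7 : (2 : ℝ) ^ ((k : ℝ) / 2) ≠ 0 := by positivity
  unfold hermiteConst
  rw [h2, h3, Real.sqrt_mul zero_le_two]
  field_simp
  ring

theorem hermiteConst_sq (k : ℕ) : hermiteConst k ^ 2 = (√Real.pi * 2 ^ k * k.factorial)⁻¹ := by
  have h1 : (Real.pi ^ ((1 : ℝ) / 4)) ^ 2 = √Real.pi := by
    rw [← Real.rpow_natCast, ← Real.rpow_mul Real.pi_pos.le, Real.sqrt_eq_rpow]; norm_num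
  have h2 : ((2 : ℝ) ^ ((k : ℝ) / 2)) ^ 2 = 2 ^ k := by
    rw [← Real.rpow_natCast, ← Real.rpow_mul zero_le_two, ← Real.rpow_natCast]; norm_num
  rw [hermiteConst, div_pow, mul_pow, mul_pow, h1, h2, Real.sq_sqrt (by positivity), ← pow_mul,
    mul_comm k, pow_mul]
  simp

/-- The three-term recurrence for Hermite functions. -/
theorem two_mul_hermiteFun (k : ℕ) (t : ℝ) :
    2 * (t * hermiteFun k t) =
      √(2 * (k + 1)) * hermiteFun (k + 1) t + √(2 * k) * hermiteFun (k - 1) t := by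
  have h1 := sqrt_mul_hermiteConst_succ k
  have hk (j : ℕ) : hermiteFun j t = hermiteConst j * Real.exp (t ^ 2 / 2) *
    iteratedDeriv j (fun s : ℝ => Real.exp (-s ^ 2)) t := rfl
  rw [hk, hk (k + 1), iteratedDeriv_succ_exp_neg_sq, hk (k - 1)]
  rcases k with _ | k
  · simp at h1 ⊢
    linear_combination 2 * t * Real.exp (t ^ 2 / 2) * Real.exp (-t ^ 2) * h1
  · have h2 := sqrt_mul_hermiteConst_succ k
    have h3 : √(2 * ((k : ℝ) + 1)) ^ 2 = 2 * (k + 1) := Real.sq_sqrt (by positivity)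
    simp only [Nat.add_sub_cancel]
    push_cast at h1 ⊢
    generalize iteratedDeriv k (fun s : ℝ => Real.exp (-s ^ 2)) t = x at *
    generalize iteratedDeriv (k + 1) (fun s : ℝ => Real.exp (-s ^ 2)) t = y at *
    generalize Real.exp (t ^ 2 / 2) = e at *
    generalize hermiteConst k = a at *
    generalize hermiteConst (k + 1) = b at *
    generalize hermiteConst (k + 1 + 1) = c at *
    generalize √(2 * ((k : ℝ) + 1)) = s at *
    generalize √(2 * ((k : ℝ) + 1 + 1)) = u at *
    linear_combination e * (2 * t * y + 2 * (k + 1) * x) * h1 + (-s * e * x) * h2 + b * e * x * h3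

/-- The derivative of a Hermite function in terms of its neighbours. -/
theorem hasDerivAt_hermiteFun (k : ℕ) (t : ℝ) :
    HasDerivAt (hermiteFun k)
      (√(2 * k) / 2 * hermiteFun (k - 1) t - √(2 * (k + 1)) / 2 * hermiteFun (k + 1) t) t := by
  have he : HasDerivAt (fun s : ℝ => Real.exp (s ^ 2 / 2)) (Real.exp (t ^ 2 / 2) * t) t := by
    have := ((hasDerivAt_pow 2 t).div_const 2).exp
    simpa using this
  have h := (he.const_mul (hermiteConst k)).mul (hasDerivAt_iteratedDeriv_exp_neg_sq k t)
  have hk (j : ℕ) : hermiteFun j t = hermiteConst j * Real.exp (t ^ 2 / 2) *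
    iteratedDeriv j (fun s : ℝ => Real.exp (-s ^ 2)) t := rfl
  refine h.congr_deriv ?_
  have h1 := two_mul_hermiteFun k t
  have h2 := sqrt_mul_hermiteConst_succ k
  rw [hk, hk (k + 1)] at h1
  rw [hk (k + 1)]
  linear_combination (1 / 2) * h1 + Real.exp (t ^ 2 / 2) *
    iteratedDeriv (k + 1) (fun s : ℝ => Real.exp (-s ^ 2)) t * h2

theorem factorial_mul_exp_div_pow_le {k : ℕ} (hk : k ≠ 0) :
    (k.factorial : ℝ) * (Real.exp 1 / k) ^ k ≤ Real.exp 1 * √k := by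
  obtain ⟨j, rfl⟩ := Nat.exists_eq_succ_of_ne_zero hk
  have h := Stirling.stirlingSeq'_antitone (Nat.zero_le j)
  rw [Function.comp_apply, Function.comp_apply, Nat.succ_eq_add_one, Nat.succ_eq_add_one, zero_add,
    Stirling.stirlingSeq_one, Stirling.stirlingSeq,
    div_le_div_iff₀ (by positivity) (by positivity), Real.sqrt_mul zero_le_two] at h
  have h2 : (0 : ℝ) < √2 := by positivity
  have hp : (((j + 1 : ℕ) : ℝ) / Real.exp 1) ^ (j + 1) *
      (Real.exp 1 / ((j + 1 : ℕ) : ℝ)) ^ (j + 1) = 1 := by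
    rw [← mul_pow, div_mul_div_cancel₀ (by positivity), div_self (by positivity), one_pow]
  have h3 : ((j + 1).factorial : ℝ) ≤
      Real.exp 1 * √((j + 1 : ℕ) : ℝ) * (((j + 1 : ℕ) : ℝ) / Real.exp 1) ^ (j + 1) := by
    refine le_of_mul_le_mul_right (h.trans_eq ?_) h2
    ring
  calc _ ≤ Real.exp 1 * √((j + 1 : ℕ) : ℝ) * (((j + 1 : ℕ) : ℝ) / Real.exp 1) ^ (j + 1) *
        (Real.exp 1 / ((j + 1 : ℕ) : ℝ)) ^ (j + 1) := by gcongr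
    _ = _ := by rw [mul_assoc, hp, mul_one]

/-- A crude uniform bound for Hermite functions. -/
theorem abs_hermiteFun_le (k : ℕ) (t : ℝ) : |hermiteFun k t| ≤ 3 * (1 + k) := by
  have hpi : 1 ≤ √Real.pi := Real.one_le_sqrt.2 (by linarith [Real.pi_gt_three])
  have hk : |hermiteFun k t| = |hermiteConst k| * (Real.exp (t ^ 2 / 2) *
      |iteratedDeriv k (fun s : ℝ => Real.exp (-s ^ 2)) t|) := by
    rw [show hermiteFun k t = hermiteConst k * Real.exp (t ^ 2 / 2) *
      iteratedDeriv k (fun s : ℝ => Real.exp (-s ^ 2)) t from rfl, abs_mul, abs_mul,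
      abs_of_pos (Real.exp_pos _), mul_assoc]
  refine abs_le_of_sq_le_sq ?_ (by positivity)
  rw [← sq_abs, hk, mul_pow, sq_abs, hermiteConst_sq]
  have he : Real.exp 1 ≤ 3 := by linarith [Real.exp_one_lt_d9]
  rcases eq_or_ne k 0 with rfl | hk0
  · have h := abs_iteratedDeriv_exp_neg_sq_le 0 t one_pos
    simp at h ⊢
    have h' : (Real.exp (t ^ 2 / 2) * Real.exp (-t ^ 2)) ^ 2 ≤ 3 ^ 2 := by
      gcongr; exact h.trans he
    have : (√Real.pi)⁻¹ ≤ 1 := inv_le_one_of_one_le₀ hpi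
    nlinarith [sq_nonneg (Real.exp (t ^ 2 / 2) * Real.exp (-t ^ 2))]
  · have hkpos : (0 : ℝ) < k := by positivity
    have h := abs_iteratedDeriv_exp_neg_sq_le k t (r := √(k / 2)) (by positivity)
    have h1 : (√((k : ℝ) / 2) ^ k) ^ 2 = (k / 2) ^ k := by
      rw [← pow_mul, mul_comm, pow_mul, Real.sq_sqrt (by positivity)]
    have h2 : (Real.exp (√((k : ℝ) / 2) ^ 2)) ^ 2 = Real.exp 1 ^ k := by
      rw [← Real.exp_nat_mul, ← Real.exp_nat_mul, Real.sq_sqrt (by positivity)]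
      congr 1; push_cast; ring
    calc _ ≤ (√Real.pi * 2 ^ k * k.factorial)⁻¹ *
          (k.factorial * Real.exp (√((k : ℝ) / 2) ^ 2) / √((k : ℝ) / 2) ^ k) ^ 2 := by gcongr
      _ = (√Real.pi)⁻¹ * (k.factorial * (Real.exp 1 / k) ^ k) := by
        rw [div_pow, mul_pow, h1, h2, div_pow, div_pow]
        field_simp
      _ ≤ 1 * (Real.exp 1 * √k) := by
        exact mul_le_mul (inv_le_one_of_one_le₀ hpi) (factorial_mul_exp_div_pow_le hk0)
          (by positivity) zero_le_one
      _ ≤ 1 * (3 * (1 + k)) := by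
        gcongr
        exact Real.sqrt_le_iff.2 ⟨by positivity, by nlinarith⟩
      _ ≤ _ := by nlinarith

section HermiteFamily

variable {n : ℕ} {h : (Fin n → ℕ) → 𝓢(EuclideanSpace ℝ (Fin n), ℂ)}

theorem hermite_update_apply
    (hh : ∀ (α : Fin n → ℕ) (x : EuclideanSpace ℝ (Fin n)),
      h α x = ∏ i, (hermiteFun (α i) (x i) : ℂ))
    (α : Fin n → ℕ) (i : Fin n) (m : ℕ) (x : EuclideanSpace ℝ (Fin n)) :
    h (Function.update α i m) x =
      hermiteFun m (x i) * ∏ j ∈ Finset.univ.erase i, (hermiteFun (α j) (x j) : ℂ) := by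
  rw [hh, ← Finset.mul_prod_erase _ _ (Finset.mem_univ i), Function.update_self]
  congr 1
  refine Finset.prod_congr rfl fun j hj => ?_
  rw [Function.update_of_ne (Finset.ne_of_mem_erase hj)]

theorem coord_mul_hermite
    (hh : ∀ (α : Fin n → ℕ) (x : EuclideanSpace ℝ (Fin n)),
      h α x = ∏ i, (hermiteFun (α i) (x i) : ℂ))
    (α : Fin n → ℕ) (i : Fin n) (x : EuclideanSpace ℝ (Fin n)) :
    (x i : ℂ) * h α x =
      (√(2 * (α i + 1)) / 2 : ℝ) * h (Function.update α i (α i + 1)) x +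
        (√(2 * α i) / 2 : ℝ) * h (Function.update α i (α i - 1)) x := by
  have h1 := congrArg (fun r : ℝ => (r : ℂ)) (two_mul_hermiteFun (α i) (x i))
  have h2 := hermite_update_apply hh α i (α i) x
  rw [Function.update_eq_self] at h2
  rw [h2, hermite_update_apply hh, hermite_update_apply hh]
  push_cast at h1 ⊢
  linear_combination (1 / 2 * ∏ j ∈ Finset.univ.erase i, (hermiteFun (α j) (x j) : ℂ)) * h1

/-- The partial derivative `∂_i h_α`, as a Schwartz function. -/
noncomputable def hermitePartial (h : (Fin n → ℕ) → 𝓢(EuclideanSpace ℝ (Fin n), ℂ))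
    (α : Fin n → ℕ) (i : Fin n) : 𝓢(EuclideanSpace ℝ (Fin n), ℂ) :=
  ((√(2 * α i) / 2 : ℝ) : ℂ) • h (Function.update α i (α i - 1)) -
    ((√(2 * (α i + 1)) / 2 : ℝ) : ℂ) • h (Function.update α i (α i + 1))

theorem fderiv_hermite
    (hh : ∀ (α : Fin n → ℕ) (x : EuclideanSpace ℝ (Fin n)),
      h α x = ∏ i, (hermiteFun (α i) (x i) : ℂ))
    (α : Fin n → ℕ) :
    fderiv ℝ (h α) = ∑ i, ContinuousLinearMap.smulRightL ℝ (EuclideanSpace ℝ (Fin n)) ℂ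
      (EuclideanSpace.proj i) ∘ hermitePartial h α i := by
  funext x
  have h1 (i : Fin n) := HasFDerivAt.comp (f := fun y : EuclideanSpace ℝ (Fin n) => y i) x
    (hasDerivAt_hermiteFun (α i) (x i)).ofReal_comp.hasFDerivAt
    (EuclideanSpace.proj (𝕜 := ℝ) i).hasFDerivAt
  have h2 := HasFDerivAt.finsetProd (u := Finset.univ) fun i _ => h1 i
  have h3 : (h α : EuclideanSpace ℝ (Fin n) → ℂ) =
      fun x => ∏ i, (hermiteFun (α i) (x i) : ℂ) := funext (hh α)
  rw [h3]
  refine (HasFDerivAt.fderiv h2).trans ?_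
  ext v
  simp [hermitePartial, hermite_update_apply hh]
  rw [← Finset.sum_sub_distrib]
  refine Finset.sum_congr rfl fun i _ => ?_
  ring

theorem one_add_sum_update_le (α : Fin n → ℕ) (i : Fin n) {m : ℕ} (hm : m ≤ α i + 1) :
    1 + ∑ j, ((Function.update α i m j : ℕ) : ℝ) ≤ 2 * (1 + ∑ j, (α j : ℝ)) := by
  have h1 : ∑ j, Function.update α i m j ≤ 1 + ∑ j, α j := by
    rw [← Finset.add_sum_erase _ _ (Finset.mem_univ i),
      ← Finset.add_sum_erase _ α (Finset.mem_univ i), Function.update_self,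
      Finset.sum_congr rfl fun j hj => Function.update_of_ne (Finset.ne_of_mem_erase hj) m α]
    lia
  have h2 : ((∑ j, Function.update α i m j : ℕ) : ℝ) ≤ ((1 + ∑ j, α j : ℕ) : ℝ) := by
    exact_mod_cast h1
  have h3 : (0 : ℝ) ≤ ∑ j, (α j : ℝ) := by positivity
  push_cast at h2
  linarith

theorem sqrt_two_mul_div_two_le (α : Fin n → ℕ) (i : Fin n) {m : ℕ} (hm : m ≤ α i + 1) :
    √(2 * m) / 2 ≤ 1 + ∑ j, (α j : ℝ) := by
  have h1 : (α i : ℝ) ≤ ∑ j, (α j : ℝ) :=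
    Finset.single_le_sum (f := fun j => (α j : ℝ)) (fun _ _ => by positivity) (Finset.mem_univ i)
  have h2 : (m : ℝ) ≤ α i + 1 := by exact_mod_cast hm
  have h3 : √(2 * m) ≤ 1 + m :=
    Real.sqrt_le_iff.2 ⟨by positivity, by nlinarith [sq_nonneg ((m : ℝ))]⟩
  have : (0 : ℝ) ≤ α i := by positivity
  linarith

/-- If `u α ≤ C (1+|α|)^N`, combinations of neighbouring terms appearing in the ladder relations
also grow polynomially. -/
theorem ladder_growth {u : (Fin n → ℕ) → ℝ} {C : ℝ} {N : ℕ} (hC : 0 ≤ C)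
    (hu : ∀ α, u α ≤ C * (1 + ∑ j, (α j : ℝ)) ^ N) (α : Fin n → ℕ) (i : Fin n) :
    √(2 * (α i + 1)) / 2 * u (Function.update α i (α i + 1)) +
      √(2 * α i) / 2 * u (Function.update α i (α i - 1)) ≤
      2 * C * 2 ^ N * (1 + ∑ j, (α j : ℝ)) ^ (N + 1) := by
  have h1 (m : ℕ) (hm : m ≤ α i + 1) :
      u (Function.update α i m) ≤ C * (2 * (1 + ∑ j, (α j : ℝ))) ^ N :=
    (hu _).trans (by gcongr; exact one_add_sum_update_le α i hm)
  have h2 : √(2 * ((α i : ℝ) + 1)) / 2 ≤ 1 + ∑ j, (α j : ℝ) :=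
    mod_cast sqrt_two_mul_div_two_le α i le_rfl
  have h3 : √(2 * (α i : ℝ)) / 2 ≤ 1 + ∑ j, (α j : ℝ) :=
    sqrt_two_mul_div_two_le α i (Nat.le_succ _)
  calc _ ≤ √(2 * (α i + 1)) / 2 * (C * (2 * (1 + ∑ j, (α j : ℝ))) ^ N) +
        √(2 * α i) / 2 * (C * (2 * (1 + ∑ j, (α j : ℝ))) ^ N) := by
        gcongr
        · exact h1 _ le_rfl
        · exact h1 _ (by omega)
    _ ≤ (1 + ∑ j, (α j : ℝ)) * (C * (2 * (1 + ∑ j, (α j : ℝ))) ^ N) +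
        (1 + ∑ j, (α j : ℝ)) * (C * (2 * (1 + ∑ j, (α j : ℝ))) ^ N) := by gcongr
    _ = _ := by rw [mul_pow]; ring

theorem EuclideanSpace.norm_le_sum_abs (x : EuclideanSpace ℝ (Fin n)) : ‖x‖ ≤ ∑ i, |x i| := by
  rw [EuclideanSpace.norm_eq]
  refine Real.sqrt_le_iff.2 ⟨by positivity, ?_⟩
  exact Finset.sum_sq_le_sq_sum_of_nonneg fun i _ => abs_nonneg _

theorem norm_pow_mul_hermite_le
    (hh : ∀ (α : Fin n → ℕ) (x : EuclideanSpace ℝ (Fin n)),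
      h α x = ∏ i, (hermiteFun (α i) (x i) : ℂ)) (k : ℕ) :
    ∃ (C : ℝ) (N : ℕ), 0 ≤ C ∧ ∀ (α : Fin n → ℕ) (x : EuclideanSpace ℝ (Fin n)),
      ‖x‖ ^ k * ‖h α x‖ ≤ C * (1 + ∑ j, (α j : ℝ)) ^ N := by
  induction k with
  | zero =>
    refine ⟨3 ^ n, n, by positivity, fun α x => ?_⟩
    rw [pow_zero, one_mul, hh, norm_prod, ← mul_pow]
    calc ∏ i, ‖(hermiteFun (α i) (x i) : ℂ)‖
        ≤ ∏ _i : Fin n, (3 * (1 + ∑ j, (α j : ℝ))) := by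
          refine Finset.prod_le_prod (fun _ _ => norm_nonneg _) fun i _ => ?_
          rw [Complex.norm_real, Real.norm_eq_abs]
          refine (abs_hermiteFun_le _ _).trans ?_
          gcongr
          exact Finset.single_le_sum (f := fun j => (α j : ℝ)) (fun _ _ => by positivity)
            (Finset.mem_univ i)
      _ = _ := by simp
  | succ k ih =>
    obtain ⟨C, N, hC, hb⟩ := ih
    refine ⟨n * (2 * C * 2 ^ N), N + 1, by positivity, fun α x => ?_⟩
    calc ‖x‖ ^ (k + 1) * ‖h α x‖ = ‖x‖ * (‖x‖ ^ k * ‖h α x‖) := by ring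
      _ ≤ (∑ i, |x i|) * (‖x‖ ^ k * ‖h α x‖) := by
        gcongr; exact EuclideanSpace.norm_le_sum_abs x
      _ = ∑ i, ‖x‖ ^ k * ‖(x i : ℂ) * h α x‖ := by
        rw [Finset.sum_mul]
        refine Finset.sum_congr rfl fun i _ => ?_
        rw [norm_mul, Complex.norm_real, Real.norm_eq_abs]; ring
      _ ≤ ∑ _i : Fin n, 2 * C * 2 ^ N * (1 + ∑ j, (α j : ℝ)) ^ (N + 1) := by
        refine Finset.sum_le_sum fun i _ => ?_
        refine le_trans ?_ (ladder_growth hC (fun α => hb α x) α i)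
        rw [coord_mul_hermite hh]
        refine (mul_le_mul_of_nonneg_left (norm_add_le _ _) (by positivity)).trans_eq ?_
        rw [norm_mul, norm_mul, Complex.norm_real, Complex.norm_real, Real.norm_of_nonneg
          (by positivity), Real.norm_of_nonneg (by positivity)]
        ring
      _ = _ := by simp; ring

/-- The Schwartz seminorms of the Hermite functions grow at most polynomially. -/
theorem seminorm_hermite_le
    (hh : ∀ (α : Fin n → ℕ) (x : EuclideanSpace ℝ (Fin n)),
      h α x = ∏ i, (hermiteFun (α i) (x i) : ℂ)) (k l : ℕ) :
    ∃ (C : ℝ) (N : ℕ), 0 ≤ C ∧ ∀ α : Fin n → ℕ,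
      SchwartzMap.seminorm ℂ k l (h α) ≤ C * (1 + ∑ j, (α j : ℝ)) ^ N := by
  induction l with
  | zero =>
    obtain ⟨C, N, hC, hb⟩ := norm_pow_mul_hermite_le hh k
    refine ⟨C, N, hC, fun α => SchwartzMap.seminorm_le_bound ℂ k 0 _ (by positivity) fun x => ?_⟩
    rw [norm_iteratedFDeriv_zero]
    exact hb α x
  | succ l ih =>
    obtain ⟨C, N, hC, hb⟩ := ih
    let L (i : Fin n) : ℂ →L[ℝ] EuclideanSpace ℝ (Fin n) →L[ℝ] ℂ :=
      ContinuousLinearMap.smulRightL ℝ _ ℂ (EuclideanSpace.proj i)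
    refine ⟨(∑ i, ‖L i‖) * (2 * C * 2 ^ N), N + 1, by positivity, fun α =>
      SchwartzMap.seminorm_le_bound ℂ k (l + 1) _ (by positivity) fun x => ?_⟩
    have hD (i : Fin n) : SchwartzMap.seminorm ℂ k l (hermitePartial h α i) ≤
        2 * C * 2 ^ N * (1 + ∑ j, (α j : ℝ)) ^ (N + 1) := by
      refine le_trans ?_ (ladder_growth hC hb α i)
      refine (map_sub_le_add _ _ _).trans_eq ?_
      rw [map_smul_eq_mul, map_smul_eq_mul, Complex.norm_real, Complex.norm_real,
        Real.norm_of_nonneg (by positivity), Real.norm_of_nonneg (by positivity), add_comm]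
    have hsm (i : Fin n) : ContDiffAt ℝ l (L i ∘ hermitePartial h α i) x :=
      (L i).contDiff.contDiffAt.comp x ((hermitePartial h α i).contDiffAt l)
    rw [← norm_iteratedFDeriv_fderiv, fderiv_hermite hh, iteratedFDeriv_sum_apply fun i _ => hsm i]
    calc ‖x‖ ^ k * ‖∑ i, iteratedFDeriv ℝ l (L i ∘ hermitePartial h α i) x‖
        ≤ ‖x‖ ^ k * ∑ i, ‖L i‖ * ‖iteratedFDeriv ℝ l (hermitePartial h α i) x‖ := by
          gcongr
          refine norm_sum_le_of_le _ fun i _ => ?_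
          exact (L i).norm_iteratedFDeriv_comp_left ((hermitePartial h α i).contDiffAt l) le_rfl
      _ = ∑ i, ‖L i‖ * (‖x‖ ^ k * ‖iteratedFDeriv ℝ l (hermitePartial h α i) x‖) := by
          rw [Finset.mul_sum]
          exact Finset.sum_congr rfl fun i _ => by ring
      _ ≤ ∑ i, ‖L i‖ * (2 * C * 2 ^ N * (1 + ∑ j, (α j : ℝ)) ^ (N + 1)) := by
          refine Finset.sum_le_sum fun i _ => mul_le_mul_of_nonneg_left ?_ (by positivity)
          exact ((hermitePartial h α i).le_seminorm ℂ k l x).trans (hD i)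
      _ = _ := by rw [← Finset.sum_mul]; ring

end HermiteFamily

/-- If `Σ_α |a_α|² (1+|α|)^m < ∞` for every `m`, then `Σ_α a_α h_α` converges in the
Schwartz space `𝒮(ℝⁿ)`, where `h_α(x) = Π_i h_{α_i}(x_i)` are the Hermite functions. -/
theorem hermite_series_converges_in_schwartz (n : ℕ)
    (h : (Fin n → ℕ) → 𝓢(EuclideanSpace ℝ (Fin n), ℂ))
    (hh : ∀ (α : Fin n → ℕ) (x : EuclideanSpace ℝ (Fin n)),
      h α x = ∏ i, (hermiteFun (α i) (x i) : ℂ))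
    (a : (Fin n → ℕ) → ℂ)
    (ha : ∀ m : ℕ, Summable (fun α : Fin n → ℕ =>
      ‖a α‖ ^ 2 * (1 + (∑ i, α i : ℝ)) ^ m)) :
    Summable (fun α : Fin n → ℕ => a α • h α) := by
  refine SchwartzMap.summable_of_summable_seminorm (𝕜 := ℂ) _ fun k l => ?_
  obtain ⟨C, N, hC, hb⟩ := seminorm_hermite_le hh k l
  refine Summable.of_nonneg_of_le (fun _ => apply_nonneg _ _) (fun α => ?_)
    (((ha (2 * N + 2 * n)).add (summable_inv_one_add_sum_pow n)).mul_left C)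
  rw [map_smul_eq_mul]
  have hw : (0 : ℝ) < 1 + ∑ i, (α i : ℝ) := by positivity
  set w : ℝ := 1 + ∑ i, (α i : ℝ)
  have h1 : ‖a α‖ * w ^ N = (‖a α‖ * w ^ (N + n)) * (w ^ n)⁻¹ := by
    rw [pow_add]; field_simp
  calc ‖a α‖ * SchwartzMap.seminorm ℂ k l (h α) ≤ ‖a α‖ * (C * w ^ N) := by gcongr; exact hb α
    _ = C * ((‖a α‖ * w ^ (N + n)) * (w ^ n)⁻¹) := by rw [← h1]; ring
    _ ≤ C * ((‖a α‖ * w ^ (N + n)) ^ 2 + ((w ^ n)⁻¹) ^ 2) := by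
      gcongr
      nlinarith [sq_nonneg (‖a α‖ * w ^ (N + n) - (w ^ n)⁻¹), sq_nonneg (‖a α‖ * w ^ (N + n)),
        sq_nonneg ((w ^ n)⁻¹)]
    _ = _ := by rw [mul_pow, inv_pow, ← pow_mul, ← pow_mul]; ring_nf
end
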